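/- arXiv:2110.06120 — 5 statements merged into one kernel-verified Lean document; each statement's English description precedes it below -/
import Mathlib

section
/- Let c > 0 and h ∈ ℝ, and define g : [0,∞) → ℂ by g(0) = -i and, for t > 0, g(t) = (e^{-iht}/(π c t)) · ∫_{-π/2}^{π/2} e^{-2ict·sin θ} sin θ dθ. Then g is differentiable on (0,∞), and for every t > 0 it satisfies the nonlinear convolutional Volterra integro-differential equation i·g'(t) - h·g(t) - c² ∫_0^t g(t-s) g(s) ds = 0. (That is, the retarded Green's function G^R(t) = -i e^{-iht} J₁(2ct)/(ct) solves the real time Dyson equation for the Bethe lattice self-energy Σ^R = c² G^R.) -/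
open Real MeasureTheory intervalIntegral

open scoped Nat
open Finset.HasAntidiagonal (antidiagonal mem_antidiagonal)

theorem catalan_le_four_pow (n : ℕ) : catalan n ≤ 4 ^ n :=
  calc catalan n ≤ (n + 1) * catalan n := Nat.le_mul_of_pos_left _ n.succ_pos
    _ = n.centralBinom := succ_mul_catalan_eq_centralBinom n
    _ ≤ 4 ^ n := n.centralBinom_le_four_pow

theorem integral_sub_pow_mul_pow (t : ℝ) (j k : ℕ) :
    ∫ s in (0 : ℝ)..t, (t - s) ^ j / j ! * (s ^ k / k !) = t ^ (j + k + 1) / (j + k + 1)! := by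
  induction j generalizing k with
  | zero =>
    simp only [pow_zero, Nat.factorial_zero, Nat.cast_one, div_one, one_mul, zero_add,
      intervalIntegral.integral_div, integral_pow, Nat.factorial_succ]
    push_cast
    field_simp
    simp
  | succ j ih =>
    have deriv_eq (s : ℝ) : HasDerivAt
        (fun s => (t - s) ^ (j + 1) / (j + 1)! * (s ^ (k + 1) / (k + 1)!))
        ((t - s) ^ (j + 1) / (j + 1)! * (s ^ k / k !) -
          (t - s) ^ j / j ! * (s ^ (k + 1) / (k + 1)!)) s := by
      have hl := (((hasDerivAt_id s).const_sub t).pow (j + 1)).div_const ((j + 1)! : ℝ)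
      have hr := ((hasDerivAt_id s).pow (k + 1)).div_const ((k + 1)! : ℝ)
      convert! hl.mul hr using 1
      simp only [Nat.factorial_succ, id, Pi.pow_apply, Nat.add_sub_cancel]
      push_cast
      field_simp
      ring
    have key := integral_eq_sub_of_hasDerivAt (a := 0) (b := t) (fun s _ => deriv_eq s)
      (Continuous.intervalIntegrable (by fun_prop) _ _)
    rw [intervalIntegral.integral_sub (Continuous.intervalIntegrable (by fun_prop) _ _)
      (Continuous.intervalIntegrable (by fun_prop) _ _), ih] at key
    simp only [sub_self, ne_eq, Nat.add_eq_zero_iff, one_ne_zero, and_false, not_false_eq_true,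
      zero_pow, zero_div, zero_mul, mul_zero] at key
    rw [sub_eq_zero.mp key]
    ring_nf

theorem integral_sin_pow_add_two_symmetric (n : ℕ) :
    ∫ θ in (-(π / 2))..(π / 2), sin θ ^ (n + 2) =
      (n + 1) / (n + 2) * ∫ θ in (-(π / 2))..(π / 2), sin θ ^ n := by
  simp [integral_sin_pow]

theorem integral_sin_pow_odd_symmetric (k : ℕ) :
    ∫ θ in (-(π / 2))..(π / 2), sin θ ^ (2 * k + 1) = 0 := by
  induction k with
  | zero => simp
  | succ k ih =>
    rw [show 2 * (k + 1) + 1 = 2 * k + 1 + 2 by ring, integral_sin_pow_add_two_symmetric, ih,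
      mul_zero]

theorem integral_sin_pow_even_symmetric (k : ℕ) :
    ∫ θ in (-(π / 2))..(π / 2), sin θ ^ (2 * k) = π * k.centralBinom / 4 ^ k := by
  induction k with
  | zero => simp
  | succ k ih =>
    have hrec : ((k : ℝ) + 1) * (k + 1).centralBinom = 2 * (2 * k + 1) * k.centralBinom :=
      mod_cast k.succ_mul_centralBinom_succ
    rw [show 2 * (k + 1) = 2 * k + 2 by ring, integral_sin_pow_add_two_symmetric, ih, pow_succ]
    push_cast
    field_simp
    linear_combination -2 * hrec

/-- The Taylor terms at zero of `t ↦ J₁(2ct)/(ct)`. -/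
noncomputable def betheTerm (c : ℝ) (k : ℕ) (t : ℝ) : ℝ :=
  (-c ^ 2) ^ k * catalan k * (t ^ (2 * k) / (2 * k)!)

/-- The function `t ↦ J₁(2ct)/(ct)`, extended by `1` at zero, as a Taylor series. -/
noncomputable def betheSeries (c t : ℝ) : ℝ := ∑' k, betheTerm c k t

theorem abs_bethe_coeff_le (c : ℝ) (k : ℕ) :
    |(-c ^ 2) ^ k * (catalan k : ℝ)| ≤ (2 * |c|) ^ (2 * k) := by
  have hcat : (catalan k : ℝ) ≤ 4 ^ k := mod_cast catalan_le_four_pow k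
  calc |(-c ^ 2) ^ k * (catalan k : ℝ)| = (|c| ^ 2) ^ k * catalan k := by simp [abs_mul]
    _ ≤ (|c| ^ 2) ^ k * 4 ^ k := by gcongr
    _ = (2 * |c|) ^ (2 * k) := by rw [pow_mul, ← mul_pow]; ring

theorem abs_betheTerm_le (c : ℝ) {t R : ℝ} (ht : |t| ≤ R) (k : ℕ) :
    |betheTerm c k t| ≤ (2 * |c| * R) ^ (2 * k) / (2 * k)! := by
  rw [betheTerm, abs_mul, abs_div, Nat.abs_cast, abs_pow, mul_pow, mul_div_assoc]
  gcongr
  exact abs_bethe_coeff_le c k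

theorem summable_pow_even_div_factorial (x : ℝ) :
    Summable fun k : ℕ => x ^ (2 * k) / (2 * k)! :=
  (Real.summable_pow_div_factorial x).comp_injective (mul_right_injective₀ two_ne_zero)

theorem summable_pow_odd_div_factorial (x : ℝ) :
    Summable fun k : ℕ => x ^ (2 * k + 1) / (2 * k + 1)! :=
  (Real.summable_pow_div_factorial x).comp_injective
    ((add_left_injective 1).comp (mul_right_injective₀ two_ne_zero))

theorem summable_abs_betheTerm (c t : ℝ) : Summable fun k => |betheTerm c k t| :=
  .of_nonneg_of_le (fun _ => abs_nonneg _) (abs_betheTerm_le c le_rfl)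
    (summable_pow_even_div_factorial _)

theorem hasSum_betheTerm (c t : ℝ) : HasSum (fun k => betheTerm c k t) (betheSeries c t) :=
  (summable_abs_betheTerm c t).of_abs.hasSum

theorem continuous_betheTerm (c : ℝ) (k : ℕ) : Continuous (betheTerm c k) := by
  unfold betheTerm
  fun_prop

theorem betheSeries_zero (c : ℝ) : betheSeries c 0 = 1 := by
  rw [betheSeries, tsum_eq_single 0]
  · simp [betheTerm]
  · intro k hk
    simp [betheTerm, hk]

theorem hasDerivAt_betheSeries (c t : ℝ) :
    HasDerivAt (betheSeries c)
      (∑' k : ℕ, (-c ^ 2) ^ (k + 1) * catalan (k + 1) * (t ^ (2 * k + 1) / (2 * k + 1)!)) t := by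
  have split : betheSeries c = fun z => betheTerm c 0 z + ∑' k, betheTerm c (k + 1) z := by
    ext z
    exact (hasSum_betheTerm c z).summable.tsum_eq_zero_add
  have hbound : Summable fun k : ℕ =>
      2 * |c| * ((2 * |c| * (|t| + 1)) ^ (2 * k + 1) / (2 * k + 1)!) :=
    (summable_pow_odd_div_factorial _).mul_left _
  have htail : HasDerivAt (fun z => ∑' k, betheTerm c (k + 1) z)
      (∑' k : ℕ, (-c ^ 2) ^ (k + 1) * catalan (k + 1) * (t ^ (2 * k + 1) / (2 * k + 1)!)) t := by
    refine hasDerivAt_tsum_of_isPreconnected (t := Metric.ball 0 (|t| + 1)) (y₀ := t) (y := t)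
      (g' := fun k y => (-c ^ 2) ^ (k + 1) * catalan (k + 1) * (y ^ (2 * k + 1) / (2 * k + 1)!))
      hbound
      Metric.isOpen_ball (convex_ball _ _).isPreconnected (fun k y _ => ?_) (fun k y hy => ?_)
      (by simp) ((summable_nat_add_iff 1).mpr (hasSum_betheTerm c t).summable) (by simp)
    · have hpow := ((hasDerivAt_pow (2 * (k + 1)) y).div_const ((2 * (k + 1))! : ℝ)).const_mul
        ((-c ^ 2) ^ (k + 1) * (catalan (k + 1) : ℝ))
      convert! hpow using 2
      rw [show 2 * (k + 1) = 2 * k + 1 + 1 by ring, Nat.factorial_succ (2 * k + 1)]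
      push_cast
      field_simp
    · rw [mem_ball_zero_iff, Real.norm_eq_abs] at hy
      rw [Real.norm_eq_abs, abs_mul, abs_div, Nat.abs_cast, abs_pow]
      calc _ ≤ (2 * |c|) ^ (2 * (k + 1)) * ((|t| + 1) ^ (2 * k + 1) / (2 * k + 1)!) := by
            gcongr
            exact abs_bethe_coeff_le c (k + 1)
        _ = _ := by rw [mul_pow (2 * |c|)]; ring
  rw [split]
  have hhead : HasDerivAt (betheTerm c 0) 0 t := by
    convert! hasDerivAt_const t (1 : ℝ) using 1
    ext z
    simp [betheTerm]
  simpa using hhead.fun_add htail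

theorem integral_sum_antidiagonal_betheTerm (c t : ℝ) (n : ℕ) :
    ∫ s in (0 : ℝ)..t, ∑ p ∈ antidiagonal n, betheTerm c p.1 (t - s) * betheTerm c p.2 s =
      (-c ^ 2) ^ n * catalan (n + 1) * (t ^ (2 * n + 1) / (2 * n + 1)!) := by
  rw [intervalIntegral.integral_finsetSum]
  · rw [catalan_succ', Nat.cast_sum, Finset.mul_sum, Finset.sum_mul]
    refine Finset.sum_congr rfl fun p hp => ?_
    rw [mem_antidiagonal] at hp
    have hterm (s : ℝ) : betheTerm c p.1 (t - s) * betheTerm c p.2 s =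
        (-c ^ 2) ^ n * (catalan p.1 * catalan p.2) *
          ((t - s) ^ (2 * p.1) / (2 * p.1)! * (s ^ (2 * p.2) / (2 * p.2)!)) := by
      rw [betheTerm, betheTerm, ← hp]
      ring
    simp only [hterm]
    rw [intervalIntegral.integral_const_mul, integral_sub_pow_mul_pow, ← mul_add, hp,
      Nat.cast_mul]
  · intro p _
    exact (((continuous_betheTerm c p.1).comp (continuous_const.sub continuous_id)).mul
      (continuous_betheTerm c p.2)).intervalIntegrable _ _

theorem hasSum_integral_betheSeries_conv (c : ℝ) {t : ℝ} (ht : 0 ≤ t) :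
    HasSum (fun n : ℕ => (-c ^ 2) ^ n * catalan (n + 1) * (t ^ (2 * n + 1) / (2 * n + 1)!))
      (∫ s in (0 : ℝ)..t, betheSeries c (t - s) * betheSeries c s) := by
  simp only [← integral_sum_antidiagonal_betheTerm]
  set B : ℕ → ℝ := fun k => (2 * |c| * t) ^ (2 * k) / (2 * k)!
  have hB : Summable B := summable_pow_even_div_factorial _
  have hB0 : 0 ≤ B := fun k => by positivity
  have hBB := summable_sum_mul_antidiagonal_of_summable_mul (hB.mul_of_nonneg hB hB0 hB0)
  refine intervalIntegral.hasSum_integral_of_dominated_convergence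
    (fun n _ => ∑ p ∈ antidiagonal n, B p.1 * B p.2) (fun n => ?_) (fun n => ?_)
    (.of_forall fun _ _ => hBB) intervalIntegrable_const (.of_forall fun s _ => ?_)
  · refine (continuous_finsetSum _ fun p _ => ?_).aestronglyMeasurable
    exact ((continuous_betheTerm c p.1).comp (continuous_const.sub continuous_id)).mul
      (continuous_betheTerm c p.2)
  · refine .of_forall fun s hs => (norm_sum_le _ _).trans (Finset.sum_le_sum fun p _ => ?_)
    rw [Set.uIoc_of_le ht] at hs
    rw [norm_mul]
    exact mul_le_mul
      (abs_betheTerm_le c (abs_le.mpr ⟨by linarith [hs.1, hs.2], by linarith [hs.1]⟩) p.1)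
      (abs_betheTerm_le c (abs_le.mpr ⟨by linarith [hs.1], hs.2⟩) p.2)
      (norm_nonneg _) (hB0 p.1)
  · have hl : Summable fun k => ‖betheTerm c k (t - s)‖ := summable_abs_betheTerm c (t - s)
    have hr : Summable fun k => ‖betheTerm c k s‖ := summable_abs_betheTerm c s
    rw [betheSeries, betheSeries, tsum_mul_tsum_eq_tsum_sum_antidiagonal_of_summable_norm hl hr]
    exact (summable_norm_sum_mul_antidiagonal_of_summable_norm hl hr).of_norm.hasSum

/-- The self-convolution equation `f' = -c² (f * f)` of `f(t) = J₁(2ct)/(ct)`. -/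
theorem hasDerivAt_betheSeries_conv (c : ℝ) {t : ℝ} (ht : 0 ≤ t) :
    HasDerivAt (betheSeries c)
      (-c ^ 2 * ∫ s in (0 : ℝ)..t, betheSeries c (t - s) * betheSeries c s) t := by
  convert! hasDerivAt_betheSeries c t using 1
  rw [← ((hasSum_integral_betheSeries_conv c ht).mul_left (-c ^ 2)).tsum_eq]
  exact tsum_congr fun n => by ring

/-- The Bessel integral representation of the Taylor series. -/
theorem integral_exp_sin_mul_sin (c t : ℝ) :
    ∫ θ in (-(π / 2))..(π / 2),
        Complex.exp (-2 * Complex.I * c * t * Real.sin θ) * (Real.sin θ : ℂ) =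
      -Complex.I * π * c * t * betheSeries c t := by
  set z : ℂ := -2 * Complex.I * c * t with hz
  have hexp : HasSum (fun n : ℕ => ∫ θ in (-(π / 2))..(π / 2),
        z ^ n / n ! * ((sin θ ^ (n + 1) : ℝ) : ℂ))
      (∫ θ in (-(π / 2))..(π / 2), Complex.exp (z * sin θ) * (sin θ : ℂ)) := by
    refine intervalIntegral.hasSum_integral_of_dominated_convergence
      (fun n _ => ‖z‖ ^ n / n !) (fun n => ?_) (fun n => .of_forall fun θ _ => ?_)
      (.of_forall fun _ _ => Real.summable_pow_div_factorial _) intervalIntegrable_const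
      (.of_forall fun θ _ => ?_)
    · exact Continuous.aestronglyMeasurable (by fun_prop)
    · rw [norm_mul, norm_div, norm_pow, Complex.norm_natCast, Complex.norm_real, norm_pow]
      exact mul_le_of_le_one_right (by positivity)
        (pow_le_one₀ (norm_nonneg _) (abs_sin_le_one θ))
    · have hs := (NormedSpace.expSeries_div_hasSum_exp (z * sin θ)).mul_right (sin θ : ℂ)
      rw [← Complex.exp_eq_exp_ℂ] at hs
      refine hs.congr_fun fun n => ?_
      push_cast
      ring
  have hodd : HasSum (fun k : ℕ => ∫ θ in (-(π / 2))..(π / 2),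
        z ^ (2 * k + 1) / (2 * k + 1)! * ((sin θ ^ (2 * k + 1 + 1) : ℝ) : ℂ))
      (∫ θ in (-(π / 2))..(π / 2), Complex.exp (z * sin θ) * (sin θ : ℂ)) := by
    refine (Function.Injective.hasSum_iff (g := fun k : ℕ => 2 * k + 1)
      ((add_left_injective 1).comp (mul_right_injective₀ two_ne_zero)) fun n hn => ?_).mpr hexp
    obtain ⟨k, rfl⟩ : Even n := by
      rw [← Nat.not_odd_iff_even]
      rintro ⟨k, rfl⟩
      exact hn ⟨k, rfl⟩
    rw [intervalIntegral.integral_const_mul, intervalIntegral.integral_ofReal, ← two_mul,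
      integral_sin_pow_odd_symmetric, Complex.ofReal_zero, mul_zero]
  refine hodd.unique ?_
  have hs := (Complex.hasSum_ofReal.mpr (hasSum_betheTerm c t)).mul_left (-Complex.I * π * c * t)
  refine hs.congr_fun fun k => ?_
  rw [intervalIntegral.integral_const_mul, intervalIntegral.integral_ofReal,
    show 2 * k + 1 + 1 = 2 * (k + 1) by ring, integral_sin_pow_even_symmetric, betheTerm]
  have hcat : ((k + 1 : ℕ) : ℂ) * (k + 1).centralBinom =
      2 * (2 * k + 1) * ((k + 1) * catalan k) := by
    exact_mod_cast (succ_mul_catalan_eq_centralBinom k).symm ▸ k.succ_mul_centralBinom_succ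
  have hk : ((k : ℂ) + 1) ≠ 0 := mod_cast k.succ_ne_zero
  have hk' : (2 * (k : ℂ) + 1) ≠ 0 := mod_cast (2 * k).succ_ne_zero
  have hcentral : ((k + 1).centralBinom : ℂ) = 2 * (2 * k + 1) * catalan k := by
    apply mul_left_cancel₀ hk
    push_cast at hcat
    linear_combination hcat
  have hzpow : z ^ (2 * k + 1) = -2 * Complex.I * c * t * (4 ^ k * (-c ^ 2) ^ k * t ^ (2 * k)) := by
    rw [pow_succ, pow_mul, pow_mul, ← mul_pow, ← mul_pow, mul_comm]
    congr 2
    rw [hz]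
    linear_combination 4 * (c : ℂ) ^ 2 * t ^ 2 * Complex.I_sq
  rw [hzpow, Nat.factorial_succ]
  push_cast
  rw [hcentral, pow_succ]
  have hf : ((2 * k)! : ℂ) ≠ 0 := mod_cast (2 * k).factorial_ne_zero
  field_simp
  ring

/-- The Bethe lattice retarded Green's function
`g(t) = -i e^{-iht} J₁(2ct)/(ct)`, given for `t > 0` by the Bessel integral
formula `g(t) = (e^{-iht}/(π c t)) ∫_{-π/2}^{π/2} e^{-2ict sin θ} sin θ dθ`
and `g(0) = -i`, is differentiable on `(0,∞)` and solves the real time Dyson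
equation for the Bethe lattice self-energy `Σ^R = c² G^R`:
`i g'(t) - h g(t) - c² ∫_0^t g(t-s) g(s) ds = 0` for all `t > 0`. -/
theorem bethe_greens_function_solves_dyson (c h : ℝ) (hc : 0 < c) (g : ℝ → ℂ)
    (hg0 : g 0 = -Complex.I)
    (hgt : ∀ t : ℝ, 0 < t →
      g t = (Complex.exp (-Complex.I * h * t) / ((π : ℂ) * c * t)) *
        ∫ θ in (-(π/2))..(π/2),
          Complex.exp (-2 * Complex.I * c * t * Real.sin θ) * (Real.sin θ : ℂ)) :
    (∀ t : ℝ, 0 < t → DifferentiableAt ℝ g t) ∧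
    (∀ t : ℝ, 0 < t →
      Complex.I * deriv g t - (h : ℂ) * g t
        - (c : ℂ)^2 * ∫ s in (0:ℝ)..t, g (t - s) * g s = 0) := by
  have hg {t : ℝ} (ht : 0 ≤ t) :
      g t = -Complex.I * (Complex.exp (-Complex.I * h * t) * betheSeries c t) := by
    obtain rfl | ht := ht.eq_or_lt
    · simp [hg0, betheSeries_zero]
    · have hπ : (π : ℂ) ≠ 0 := mod_cast pi_ne_zero
      have hc' : (c : ℂ) ≠ 0 := mod_cast hc.ne'
      have ht' : (t : ℂ) ≠ 0 := mod_cast ht.ne'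
      rw [hgt t ht, integral_exp_sin_mul_sin]
      field_simp
  have hconv {t : ℝ} (ht : 0 ≤ t) : ∫ s in (0 : ℝ)..t, g (t - s) * g s =
      -Complex.exp (-Complex.I * h * t) *
        ((∫ s in (0 : ℝ)..t, betheSeries c (t - s) * betheSeries c s : ℝ) : ℂ) := by
    rw [← intervalIntegral.integral_ofReal, ← intervalIntegral.integral_const_mul]
    refine intervalIntegral.integral_congr fun s hs => ?_
    rw [Set.uIcc_of_le ht] at hs
    have hexp : Complex.exp (-Complex.I * h * t) =
        Complex.exp (-Complex.I * h * (t - s : ℝ)) * Complex.exp (-Complex.I * h * s) := by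
      rw [← Complex.exp_add]
      push_cast
      ring_nf
    simp only [hg hs.1, hg (sub_nonneg.mpr hs.2), hexp, Complex.ofReal_mul]
    linear_combination Complex.exp (-Complex.I * h * (t - s : ℝ)) *
      Complex.exp (-Complex.I * h * s) * betheSeries c (t - s) * betheSeries c s * Complex.I_sq
  have hderiv {t : ℝ} (ht : 0 < t) : HasDerivAt g
      (-Complex.I * (Complex.exp (-Complex.I * h * t) * (-Complex.I * h) * betheSeries c t +
        Complex.exp (-Complex.I * h * t) *
          ((-c ^ 2 * ∫ s in (0 : ℝ)..t, betheSeries c (t - s) * betheSeries c s : ℝ) : ℂ))) t := by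
    have hexp : HasDerivAt (fun s : ℝ => Complex.exp (-Complex.I * h * s))
        (Complex.exp (-Complex.I * h * t) * (-Complex.I * h)) t := by
      simpa using ((Complex.ofRealCLM.hasDerivAt (x := t)).const_mul (-Complex.I * h)).cexp
    refine ((hexp.mul (hasDerivAt_betheSeries_conv c ht.le).ofReal_comp).const_mul
      (-Complex.I)).congr_of_eventuallyEq ?_
    filter_upwards [lt_mem_nhds ht] with s hs using hg hs.le
  refine ⟨fun t ht => (hderiv ht).differentiableAt, fun t ht => ?_⟩
  rw [(hderiv ht).deriv, hconv ht.le, hg ht.le]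
  push_cast
  linear_combination (-(Complex.exp (-Complex.I * h * t) * (-Complex.I * h) * betheSeries c t +
    Complex.exp (-Complex.I * h * t) *
      (-(c : ℂ) ^ 2 * (∫ s in (0 : ℝ)..t, betheSeries c (t - s) * betheSeries c s : ℝ)))) *
    Complex.I_sq
end

section
/- Let c > 0 and h ∈ ℝ. Then lim_{t→0⁺} (e^{-iht}/(π c t)) · ∫_{-π/2}^{π/2} e^{-2ict·sin θ} sin θ dθ = -i. In particular the Bethe lattice retarded Green's function g, defined by g(0) = -i and g(t) = (e^{-iht}/(π c t)) ∫_{-π/2}^{π/2} e^{-2ict·sin θ} sin θ dθ for t > 0, is continuous at t = 0 and satisfies the initial condition G^R(0) = -i of the Dyson equation. -/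
open Real MeasureTheory intervalIntegral Filter

/-- The Bessel-type integral `∫ e^{-2icts} s` with `s = sin θ` has derivative `-iπc` in `t` at `0`. -/
lemma hasDerivAt_integral_exp_sin_mul_sin (c : ℝ) :
    HasDerivAt (fun t : ℝ => ∫ θ in (-(π/2))..(π/2),
      Complex.exp (-2 * Complex.I * c * t * Real.sin θ) * (Real.sin θ : ℂ))
      (-Complex.I * (π * c)) 0 := by
  have key := (intervalIntegral.hasDerivAt_integral_of_dominated_loc_of_deriv_le
    (μ := volume) (a := -(π/2)) (b := π/2) (s := Set.univ) (x₀ := (0 : ℝ))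
    (F := fun (t θ : ℝ) =>
      Complex.exp (-2 * Complex.I * c * t * Real.sin θ) * (Real.sin θ : ℂ))
    (F' := fun (t θ : ℝ) => Complex.exp (-2 * Complex.I * c * t * Real.sin θ) *
      (-2 * Complex.I * c * Real.sin θ) * (Real.sin θ : ℂ))
    (bound := fun _ => 2 * |c|) univ_mem
    (.of_forall fun t => Continuous.aestronglyMeasurable (by fun_prop))
    (Continuous.intervalIntegrable (by fun_prop) _ _)
    (Continuous.aestronglyMeasurable (by fun_prop))
    (.of_forall fun θ _ t _ => ?_) intervalIntegrable_const
    (.of_forall fun θ _ t _ => ?_)).2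
  · refine key.congr_deriv ?_
    have hsq : ∀ θ : ℝ, Complex.exp (-2 * Complex.I * c * (0 : ℝ) * Real.sin θ) *
        (-2 * Complex.I * c * Real.sin θ) * (Real.sin θ : ℂ) =
        (-2 * Complex.I * c) * ((Real.sin θ ^ 2 : ℝ) : ℂ) := fun θ => by
      push_cast
      simp only [mul_zero, zero_mul, Complex.exp_zero]
      ring
    rw [intervalIntegral.integral_congr fun θ _ => hsq θ,
      intervalIntegral.integral_const_mul, intervalIntegral.integral_ofReal,
      integral_sin_sq]
    simp only [Real.sin_neg, Real.cos_neg, Real.cos_pi_div_two]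
    push_cast
    ring
  · have hexp : ‖Complex.exp (-2 * Complex.I * c * t * Real.sin θ)‖ = 1 := by
      rw [Complex.norm_exp]
      simp [-Complex.ofReal_sin]
    rw [norm_mul, norm_mul, hexp]
    simp only [norm_mul, norm_neg, Complex.norm_I, Complex.norm_real, Real.norm_eq_abs,
      Complex.norm_ofNat, one_mul, mul_one]
    have h1 := Real.abs_sin_le_one θ
    calc 2 * |c| * |Real.sin θ| * |Real.sin θ| ≤ 2 * |c| * 1 * 1 := by gcongr
      _ = 2 * |c| := by ring
  · have hlin : HasDerivAt (fun t : ℝ => -2 * Complex.I * c * t * Real.sin θ)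
        (-2 * Complex.I * c * Real.sin θ) t := by
      simpa using ((Complex.ofRealCLM.hasDerivAt (x := t)).const_mul
        (-2 * Complex.I * c)).mul_const (Real.sin θ : ℂ)
    exact hlin.cexp.mul_const _

/-- For `c > 0` and `h ∈ ℝ`,
`lim_{t→0⁺} (e^{-iht}/(π c t)) ∫_{-π/2}^{π/2} e^{-2ict sin θ} sin θ dθ = -i`.
In particular the Bethe lattice retarded Green's function `g`, defined by
`g(0) = -i` and by this formula for `t > 0`, is continuous at `t = 0` (from the
right) and satisfies the initial condition `G^R(0) = -i` of the Dyson equation. -/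
theorem bethe_greens_function_initial_condition (c h : ℝ) (hc : 0 < c) (g : ℝ → ℂ)
    (hg0 : g 0 = -Complex.I)
    (hgt : ∀ t : ℝ, 0 < t →
      g t = (Complex.exp (-Complex.I * h * t) / ((π : ℂ) * c * t)) *
        ∫ θ in (-(π/2))..(π/2),
          Complex.exp (-2 * Complex.I * c * t * Real.sin θ) * (Real.sin θ : ℂ)) :
    Tendsto (fun t : ℝ =>
        (Complex.exp (-Complex.I * h * t) / ((π : ℂ) * c * t)) *
          ∫ θ in (-(π/2))..(π/2),
            Complex.exp (-2 * Complex.I * c * t * Real.sin θ) * (Real.sin θ : ℂ))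
      (nhdsWithin 0 (Set.Ioi 0)) (nhds (-Complex.I)) ∧
    ContinuousWithinAt g (Set.Ici 0) 0 ∧ g 0 = -Complex.I := by
  have hlim : Tendsto (fun t : ℝ =>
        (Complex.exp (-Complex.I * h * t) / ((π : ℂ) * c * t)) *
          ∫ θ in (-(π/2))..(π/2),
            Complex.exp (-2 * Complex.I * c * t * Real.sin θ) * (Real.sin θ : ℂ))
      (nhdsWithin 0 (Set.Ioi 0)) (nhds (-Complex.I)) := by
    have hslope := (hasDerivAt_integral_exp_sin_mul_sin c).tendsto_slope_zero_right
    have hphase : Tendsto (fun t : ℝ => Complex.exp (-Complex.I * h * t) / ((π : ℂ) * c))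
        (nhdsWithin 0 (Set.Ioi 0)) (nhds (1 / ((π : ℂ) * c))) := by
      have hcont : Continuous fun t : ℝ => Complex.exp (-Complex.I * h * t) / ((π : ℂ) * c) := by
        fun_prop
      simpa using (hcont.tendsto 0).mono_left nhdsWithin_le_nhds
    have hzero : ∫ θ in (-(π/2))..(π/2), (Real.sin θ : ℂ) = 0 := by
      rw [intervalIntegral.integral_ofReal, integral_sin]
      simp
    have hpc : (π : ℂ) * c ≠ 0 := by
      exact_mod_cast (mul_pos Real.pi_pos hc).ne'
    have hval : 1 / ((π : ℂ) * c) * (-Complex.I * (π * c)) = -Complex.I := by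
      rw [mul_comm (-Complex.I), ← mul_assoc, one_div_mul_cancel hpc, one_mul]
    have hprod := hphase.mul hslope
    rw [hval] at hprod
    refine hprod.congr fun t => ?_
    simp only [zero_add, Complex.ofReal_zero, mul_zero, zero_mul, Complex.exp_zero, one_mul,
      hzero, sub_zero, Complex.real_smul, Complex.ofReal_inv]
    ring
  refine ⟨hlim, ?_, hg0⟩
  rw [← continuousWithinAt_Ioi_iff_Ici, ContinuousWithinAt, hg0]
  exact hlim.congr' (eventually_nhdsWithin_of_forall fun t ht => (hgt t ht).symm)
end

section
/- Let c > 0, h ∈ ℝ, and t ∈ ℝ with t ≠ 0. Then ∫_{h-2c}^{h+2c} e^{-iωt} √(4c² - (ω-h)²) dω = (i/t) ∫_{h-2c}^{h+2c} ((ω-h) e^{-iωt} / √(4c² - (ω-h)²)) dω, where the integral on the right-hand side is an absolutely convergent improper integral (the integrand has integrable inverse-square-root singularities at the endpoints). -/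
open Real MeasureTheory intervalIntegral

theorem hasDerivAt_arcsin_sub_div {R h x : ℝ} (hx : x ∈ Set.Ioo (h - R) (h + R)) :
    HasDerivAt (fun y => arcsin ((y - h) / R)) (1 / √(R ^ 2 - (x - h) ^ 2)) x := by
  obtain ⟨hx₁, hx₂⟩ := hx
  have hR : 0 < R := by linarith
  have hlow : (x - h) / R ≠ -1 := by
    rw [Ne, div_eq_iff hR.ne']; intro H; linarith
  have hupp : (x - h) / R ≠ 1 := by
    rw [Ne, div_eq_iff hR.ne']; intro H; linarith
  have hsqrt : √(R ^ 2 - (x - h) ^ 2) = R * √(1 - ((x - h) / R) ^ 2) := by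
    rw [show R ^ 2 - (x - h) ^ 2 = R ^ 2 * (1 - ((x - h) / R) ^ 2) by field_simp,
      sqrt_mul (sq_nonneg R), sqrt_sq hR.le]
  have hlin : HasDerivAt (fun y => (y - h) / R) (1 / R) x :=
    ((hasDerivAt_id x).sub_const h).div_const R
  refine ((hasDerivAt_arcsin hlow hupp).comp x hlin).congr_deriv ?_
  rw [hsqrt, one_div_mul_one_div, mul_comm]

theorem intervalIntegrable_one_div_sqrt_sq_sub_sq {R : ℝ} (hR : 0 ≤ R) (h : ℝ) :
    IntervalIntegrable (fun x => 1 / √(R ^ 2 - (x - h) ^ 2)) volume (h - R) (h + R) := by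
  have hle : h - R ≤ h + R := by linarith
  refine intervalIntegrable_deriv_of_nonneg (g := fun y => arcsin ((y - h) / R))
    (by fun_prop) (fun x hx => ?_) fun x _ => by positivity
  rw [min_eq_left hle, max_eq_right hle] at hx
  exact hasDerivAt_arcsin_sub_div hx

theorem hasDerivAt_sqrt_sq_sub_sq {R h x : ℝ} (hx : x ∈ Set.Ioo (h - R) (h + R)) :
    HasDerivAt (fun y => √(R ^ 2 - (y - h) ^ 2))
      (-((x - h) * (1 / √(R ^ 2 - (x - h) ^ 2)))) x := by
  have hpos : 0 < R ^ 2 - (x - h) ^ 2 := by nlinarith [hx.1, hx.2]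
  have hpoly : HasDerivAt (fun y => R ^ 2 - (y - h) ^ 2) (-(2 * (x - h))) x := by
    simpa using (((hasDerivAt_id x).sub_const h).pow 2).const_sub (R ^ 2)
  refine (hpoly.sqrt hpos.ne').congr_deriv ?_
  field_simp

theorem hasDerivAt_I_div_mul_exp {t : ℝ} (ht : t ≠ 0) (x : ℝ) :
    HasDerivAt (fun y : ℝ => Complex.I / t * Complex.exp (-Complex.I * y * t))
      (Complex.exp (-Complex.I * x * t)) x := by
  have hlin : HasDerivAt (fun y : ℝ => -Complex.I * y * t) (-Complex.I * 1 * t) x :=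
    ((Complex.ofRealCLM.hasDerivAt (x := x)).const_mul _).mul_const _
  refine (hlin.cexp.const_mul (Complex.I / t)).congr_deriv ?_
  have ht' : (t : ℂ) ≠ 0 := by exact_mod_cast ht
  field_simp
  simp

/-- Integration by parts step for the inverse Fourier transform of the
semicircular spectral density: for `c > 0`, `h ∈ ℝ`, `t ≠ 0`,
`∫_{h-2c}^{h+2c} e^{-iωt} √(4c² - (ω-h)²) dω
  = (i/t) ∫_{h-2c}^{h+2c} (ω-h) e^{-iωt} / √(4c² - (ω-h)²) dω`,
and the integrand on the right-hand side is (interval) integrable. -/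
theorem semicircle_fourier_integration_by_parts (c h t : ℝ) (hc : 0 < c) (ht : t ≠ 0) :
    IntervalIntegrable
      (fun ω : ℝ => ((ω : ℂ) - h) * Complex.exp (-Complex.I * ω * t) /
        (Real.sqrt (4 * c^2 - (ω - h)^2) : ℂ))
      volume (h - 2*c) (h + 2*c) ∧
    (∫ ω in (h - 2*c)..(h + 2*c),
        Complex.exp (-Complex.I * ω * t) * (Real.sqrt (4 * c^2 - (ω - h)^2) : ℂ))
      = (Complex.I / t) *
        ∫ ω in (h - 2*c)..(h + 2*c),
          ((ω : ℂ) - h) * Complex.exp (-Complex.I * ω * t) /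
            (Real.sqrt (4 * c^2 - (ω - h)^2) : ℂ) := by
  have hle : h - 2 * c ≤ h + 2 * c := by linarith
  rw [show 4 * c ^ 2 = (2 * c) ^ 2 by ring]
  have hint := intervalIntegrable_one_div_sqrt_sq_sub_sq (R := 2 * c) (by positivity) h
  have hintC : IntervalIntegrable (fun x : ℝ => ((1 / √((2 * c) ^ 2 - (x - h) ^ 2) : ℝ) : ℂ))
      volume (h - 2 * c) (h + 2 * c) := ⟨hint.1.ofReal, hint.2.ofReal⟩
  constructor
  · refine (hintC.continuousOn_mul (g := fun x : ℝ => ((x : ℂ) - h) *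
      Complex.exp (-Complex.I * x * t)) (by fun_prop)).congr fun x _ => ?_
    push_cast
    ring
  · have key := integral_mul_deriv_eq_deriv_mul_of_hasDerivAt
      (a := h - 2 * c) (b := h + 2 * c)
      (u := fun x : ℝ => ((√((2 * c) ^ 2 - (x - h) ^ 2) : ℝ) : ℂ))
      (u' := fun x : ℝ => ((-((x - h) * (1 / √((2 * c) ^ 2 - (x - h) ^ 2))) : ℝ) : ℂ))
      (v := fun x : ℝ => Complex.I / t * Complex.exp (-Complex.I * x * t))
      (v' := fun x : ℝ => Complex.exp (-Complex.I * x * t))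
      (by fun_prop) (by fun_prop)
      (fun x hx => by
        rw [min_eq_left hle, max_eq_right hle] at hx
        exact (hasDerivAt_sqrt_sq_sub_sq hx).ofReal_comp)
      (fun x _ => hasDerivAt_I_div_mul_exp ht x)
      (by
        have hneg := (hint.continuousOn_mul (g := fun x => x - h) (by fun_prop)).neg
        exact ⟨hneg.1.ofReal, hneg.2.ofReal⟩)
      (Continuous.intervalIntegrable (by fun_prop) _ _)
    simp_rw [mul_comm (Complex.exp _) (Complex.ofReal _)]
    rw [key, ← intervalIntegral.integral_const_mul]
    simp only [add_sub_cancel_left, sub_sub_cancel_left, neg_sq, sub_self, sqrt_zero,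
      Complex.ofReal_zero, zero_mul, zero_sub]
    rw [← intervalIntegral.integral_neg]
    refine integral_congr fun x _ => ?_
    push_cast
    ring
end

section
/- Let c > 0, h ∈ ℝ, and t > 0. Then -i ∫_{h-2c}^{h+2c} e^{-iωt} · (√(4c² - (ω-h)²)/(2πc²)) dω = (e^{-iht}/(π c t)) ∫_{-π/2}^{π/2} e^{-2ict·sin θ} sin θ dθ. That is, the inverse Fourier transform -i ∫_{-∞}^{∞} e^{-iωt} A(ω) dω of the semicircular spectral density A equals the Bethe lattice retarded Green's function g(t) = -i e^{-iht} J₁(2ct)/(ct). -/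
open Real MeasureTheory intervalIntegral

/-- Integration by parts for the Bessel integral: the `cos ^ 2` form against the `sin` form. -/
theorem mul_integral_cexp_mul_sin_mul_cos_sq (a : ℂ) :
    a * ∫ θ in (-(π/2))..(π/2), Complex.exp (a * Real.sin θ) * (Real.cos θ : ℂ) ^ 2
      = ∫ θ in (-(π/2))..(π/2), Complex.exp (a * Real.sin θ) * (Real.sin θ : ℂ) := by
  have hcos : ∀ θ ∈ Set.uIcc (-(π/2)) (π/2),
      HasDerivAt (fun θ : ℝ => (Real.cos θ : ℂ)) ((-Real.sin θ : ℝ) : ℂ) θ :=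
    fun θ _ => (Real.hasDerivAt_cos θ).ofReal_comp
  have hexp : ∀ θ ∈ Set.uIcc (-(π/2)) (π/2),
      HasDerivAt (fun θ : ℝ => Complex.exp (a * Real.sin θ))
        (Complex.exp (a * Real.sin θ) * (a * Real.cos θ)) θ :=
    fun θ _ => ((Real.hasDerivAt_sin θ).ofReal_comp.const_mul a).cexp
  have hparts := integral_mul_deriv_eq_deriv_mul hcos hexp
    (Continuous.intervalIntegrable (by fun_prop) _ _)
    (Continuous.intervalIntegrable (by fun_prop) _ _)
  simp only [Real.cos_neg, Real.cos_pi_div_two, Complex.ofReal_zero, zero_mul, sub_zero,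
    Complex.ofReal_neg, neg_mul, intervalIntegral.integral_neg, zero_sub, neg_neg] at hparts
  rw [← intervalIntegral.integral_const_mul]
  calc
    _ = ∫ θ in (-(π/2))..(π/2),
          (Real.cos θ : ℂ) * (Complex.exp (a * Real.sin θ) * (a * Real.cos θ)) :=
      intervalIntegral.integral_congr fun θ _ => by ring
    _ = ∫ θ in (-(π/2))..(π/2), (Real.sin θ : ℂ) * Complex.exp (a * Real.sin θ) := hparts
    _ = _ := intervalIntegral.integral_congr fun θ _ => mul_comm _ _

/-- The substitution `ω = h + r * sin θ` over an interval of radius `r` centred at `h`. -/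
theorem integral_eq_integral_comp_add_mul_sin {g : ℝ → ℂ} (hg : Continuous g) (h r : ℝ) :
    ∫ ω in (h - r)..(h + r), g ω
      = ∫ θ in (-(π/2))..(π/2), ((r * Real.cos θ : ℝ) : ℂ) * g (h + r * Real.sin θ) := by
  have hsubst := integral_deriv_smul_comp (a := -(π/2)) (b := π/2)
    (f := fun θ => h + r * Real.sin θ) (f' := fun θ => r * Real.cos θ) (g := g)
    (fun θ _ => ((Real.hasDerivAt_sin θ).const_mul r).const_add h)
    (by fun_prop) hg
  simpa [← sub_eq_add_neg] using hsubst.symm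

/-- For `c > 0`, `h ∈ ℝ`, and `t > 0`, the inverse Fourier transform
`-i ∫ e^{-iωt} A(ω) dω` of the semicircular spectral density
`A(ω) = √(4c² - (ω-h)²)/(2πc²)` (supported on `(ω-h)² < 4c²`) equals the Bethe
lattice retarded Green's function
`g(t) = (e^{-iht}/(π c t)) ∫_{-π/2}^{π/2} e^{-2ict sin θ} sin θ dθ
      = -i e^{-iht} J₁(2ct)/(ct)`. -/
theorem semicircle_inverse_fourier_eq_bethe_greens_function (c h t : ℝ)
    (hc : 0 < c) (ht : 0 < t) :
    -Complex.I * ∫ ω in (h - 2*c)..(h + 2*c),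
        Complex.exp (-Complex.I * ω * t) *
          ((Real.sqrt (4 * c^2 - (ω - h)^2) : ℂ) / (2 * (π : ℂ) * c^2))
      = (Complex.exp (-Complex.I * h * t) / ((π : ℂ) * c * t)) *
        ∫ θ in (-(π/2))..(π/2),
          Complex.exp (-2 * Complex.I * c * t * Real.sin θ) * (Real.sin θ : ℂ) := by
  have hcC : (c : ℂ) ≠ 0 := by exact_mod_cast hc.ne'
  have htC : (t : ℂ) ≠ 0 := by exact_mod_cast ht.ne'
  have hpiC : (π : ℂ) ≠ 0 := by exact_mod_cast Real.pi_ne_zero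
  rw [integral_eq_integral_comp_add_mul_sin (by fun_prop),
    ← mul_integral_cexp_mul_sin_mul_cos_sq (-2 * Complex.I * c * t)]
  have hintegrand : ∀ θ ∈ Set.uIcc (-(π/2)) (π/2),
      ((2 * c * Real.cos θ : ℝ) : ℂ) *
        (Complex.exp (-Complex.I * (h + 2 * c * Real.sin θ : ℝ) * t) *
          ((Real.sqrt (4 * c^2 - (h + 2 * c * Real.sin θ - h)^2) : ℂ) / (2 * (π : ℂ) * c^2)))
      = (Complex.exp (-Complex.I * h * t) * (2 / π)) *
        (Complex.exp (-2 * Complex.I * c * t * Real.sin θ) * (Real.cos θ : ℂ) ^ 2) := by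
    intro θ hθ
    rw [Set.uIcc_of_le (by linarith [Real.pi_pos])] at hθ
    have hsqrt : Real.sqrt (4 * c^2 - (h + 2 * c * Real.sin θ - h)^2) = 2 * c * Real.cos θ := by
      have hcos : 0 ≤ 2 * c * Real.cos θ :=
        mul_nonneg (by positivity) (Real.cos_nonneg_of_mem_Icc hθ)
      rw [← Real.sqrt_sq hcos]
      congr 1
      linear_combination (-4 * c^2) * Real.sin_sq_add_cos_sq θ
    have hexp : Complex.exp (-Complex.I * (h + 2 * c * Real.sin θ : ℝ) * t)
        = Complex.exp (-Complex.I * h * t) *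
          Complex.exp (-2 * Complex.I * c * t * Real.sin θ) := by
      rw [← Complex.exp_add]
      congr 1
      push_cast
      ring
    rw [hsqrt, hexp, Complex.ofReal_mul, Complex.ofReal_mul, Complex.ofReal_ofNat]
    field_simp
  rw [intervalIntegral.integral_congr hintegrand, intervalIntegral.integral_const_mul]
  field_simp
end

section
/- Let N be a real number with N ≥ 2, and let L be a positive integer with 2^L ≤ N. Then ∑_{l=1}^{L} (N/2^l) · log₂(N/2^l) · (L - l + 2) ≤ N · (log₂ N)². (This establishes the O(N log² N) total cost of applying all square units in the modified fast history summation algorithm for Volterra kernels with a kernel nonlinearity.) -/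
open Real Finset

theorem sum_Icc_one_div_two_pow (L : ℕ) :
    ∑ l ∈ Finset.Icc 1 L, (1 : ℝ) / 2 ^ l = 1 - 1 / 2 ^ L := by
  induction L with
  | zero => simp
  | succ k ih =>
    rw [Finset.sum_Icc_succ_top (by omega), ih]
    field_simp
    ring

/-- `O(N log² N)` total cost of applying all square units in the modified fast
history summation algorithm for kernel nonlinearities: summing the per-unit
bound `(N/2^l) log₂(N/2^l) (L - l + 2)` over levels `l = 1,…,L` with `2^L ≤ N`
gives at most `N (log₂ N)²`. -/
theorem square_units_total_cost (N : ℝ) (hN : 2 ≤ N) (L : ℕ) (hL : 0 < L)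
    (hLN : (2:ℝ)^L ≤ N) :
    ∑ l ∈ Finset.Icc 1 L,
        (N / 2^l) * Real.logb 2 (N / 2^l) * ((L : ℝ) - l + 2)
      ≤ N * (Real.logb 2 N)^2 := by
  have hN0 : 0 < N := by linarith
  set x := Real.logb 2 N with hx
  have hLx : (L : ℝ) ≤ x := by
    rw [hx, Real.le_logb_iff_rpow_le (by norm_num) hN0, Real.rpow_natCast]
    exact hLN
  have hterm : ∀ l ∈ Finset.Icc 1 L,
      (N / 2^l) * Real.logb 2 (N / 2^l) * ((L : ℝ) - l + 2) ≤ N * x ^ 2 * (1 / 2 ^ l) := by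
    intro l hl
    obtain ⟨h1, h2⟩ := Finset.mem_Icc.mp hl
    have h1' : (1 : ℝ) ≤ l := by exact_mod_cast h1
    have h2' : (l : ℝ) ≤ L := by exact_mod_cast h2
    have hlog : Real.logb 2 (N / 2^l) = x - l := by
      rw [Real.logb_div hN0.ne' (by positivity), Real.logb_pow, Real.logb_self_eq_one (by norm_num),
        mul_one]
    have hkey : (x - l) * ((L : ℝ) - l + 2) ≤ x ^ 2 := by
      have hmono : (x - l) * ((L : ℝ) - l + 2) ≤ (x - l) * (x - l + 2) :=
        mul_le_mul_of_nonneg_left (by linarith) (by linarith)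
      nlinarith
    calc (N / 2^l) * Real.logb 2 (N / 2^l) * ((L : ℝ) - l + 2)
        = (N / 2^l) * ((x - l) * ((L : ℝ) - l + 2)) := by rw [hlog, mul_assoc]
      _ ≤ (N / 2^l) * x ^ 2 := mul_le_mul_of_nonneg_left hkey (by positivity)
      _ = N * x ^ 2 * (1 / 2 ^ l) := by ring
  refine (Finset.sum_le_sum hterm).trans ?_
  rw [← Finset.mul_sum, sum_Icc_one_div_two_pow]
  have hpos : (0 : ℝ) ≤ 1 / 2 ^ L := by positivity
  exact mul_le_of_le_one_right (by positivity) (by linarith)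
end
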